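/- Fix q' > 0 and e' ∈ (0,1), and let Q' = q'(1+e')/(1−e'). If (q,e) with q > 0 and e ∈ [0,1] satisfies q' − q(1+e)/(1−e) ≤ 0 (interpreted as automatically true when e = 1) and q − Q' ≤ 0, then there exists (ω,ω') ∈ [0,π/2] × [0,π] such that d⁺(q,e,ω,ω') · d⁻(q,e,ω,ω') = 0, i.e. there is a crossing configuration. -/

import Mathlib

open Real Set Filter Topology

noncomputable section

/-- `a / b` as an extended real, with the convention that it equals `+∞` when `b = 0`. -/
noncomputable def equot (a b : ℝ) : EReal := if b = 0 then ⊤ else ((a / b : ℝ) : EReal)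

noncomputable def rplus (q e ω : ℝ) : EReal := equot (q * (1 + e)) (1 + e * Real.cos ω)

noncomputable def rminus (q e ω : ℝ) : EReal := equot (q * (1 + e)) (1 - e * Real.cos ω)

noncomputable def dplus (q' e' q e ω ω' : ℝ) : EReal :=
  equot (q' * (1 + e')) (1 + e' * Real.cos ω') - rplus q e ω

noncomputable def dminus (q' e' q e ω ω' : ℝ) : EReal :=
  equot (q' * (1 + e')) (1 - e' * Real.cos ω') - rminus q e ω

noncomputable def deltaNod (q' e' q e ω ω' : ℝ) : EReal :=
  min (max (dplus q' e' q e ω ω') (-dplus q' e' q e ω ω'))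
      (max (dminus q' e' q e ω ω') (-dminus q' e' q e ω ω'))

noncomputable def deltaInt (q' e' q e ω ω' : ℝ) : EReal :=
  min (dplus q' e' q e ω ω') (dminus q' e' q e ω ω')

noncomputable def deltaExt (q' e' q e ω ω' : ℝ) : EReal :=
  min (-dplus q' e' q e ω ω') (-dminus q' e' q e ω ω')

noncomputable def deltaLink (q' e' q e ω ω' : ℝ) : EReal :=
  max (min (-dplus q' e' q e ω ω') (dminus q' e' q e ω ω'))
      (min (dplus q' e' q e ω ω') (-dminus q' e' q e ω ω'))


theorem equot_sub_zero {a b c d : ℝ} (hb : b ≠ 0) (hd : d ≠ 0) (h : a * d = c * b) :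
    equot a b - equot c d = 0 := by
  have : a / b = c / d := by rw [div_eq_div_iff hb hd, h]
  simp only [equot, if_neg hb, if_neg hd]
  rw [← EReal.coe_sub, this, sub_self, EReal.coe_zero]

/-- If `ℓ^e_int = q' - q(1+e)/(1-e) ≤ 0` (automatic when `e = 1`) and `ℓ^e_ext = q - Q' ≤ 0`,
then some `(ω, ω') ∈ [0,π/2] × [0,π]` gives a crossing configuration, i.e. `d⁺ · d⁻ = 0`. -/
theorem exists_crossing_qe (q' e' : ℝ) (hq' : 0 < q') (he' : e' ∈ Ioo (0 : ℝ) 1)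
    (Q' : ℝ) (hQ' : Q' = q' * (1 + e') / (1 - e'))
    (q e : ℝ) (hq : 0 < q) (he : e ∈ Icc (0 : ℝ) 1)
    (hint : (q' : EReal) - equot (q * (1 + e)) (1 - e) ≤ 0)
    (hext : q - Q' ≤ 0) :
    ∃ ω ∈ Icc (0 : ℝ) (π / 2), ∃ ω' ∈ Icc (0 : ℝ) π,
      dplus q' e' q e ω ω' * dminus q' e' q e ω ω' = 0 := by
  obtain ⟨e0, e1⟩ := he
  obtain ⟨f0, f1⟩ := he'
  have hp : 0 < q * (1 + e) := by positivity
  have hp' : 0 < q' * (1 + e') := by positivity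
  have hf : 0 < 1 - e' := by linarith
  have hint' : q' * (1 - e) ≤ q * (1 + e) := by
    rcases eq_or_lt_of_le e1 with h | h
    · subst h; simp; linarith
    · have h1 : 0 < 1 - e := by linarith
      rw [equot, if_neg h1.ne', ← EReal.coe_sub] at hint
      have h2 : q' - q * (1 + e) / (1 - e) ≤ 0 := by exact_mod_cast hint
      rw [← le_div_iff₀ h1]; linarith
  have hQ : Q' * (1 - e') = q' * (1 + e') := by rw [hQ']; field_simp
  have hQ0 : 0 < Q' := by linarith
  have key : ∀ c ∈ Icc (0:ℝ) 1, Real.arccos c ∈ Icc 0 (π / 2) ∧ Real.cos (Real.arccos c) = c :=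
    fun c hc => ⟨⟨Real.arccos_nonneg c, Real.arccos_le_pi_div_two.2 hc.1⟩,
      Real.cos_arccos (by linarith [hc.1]) hc.2⟩
  rcases lt_or_ge (q * (1 + e)) q' with h1 | h1
  · have e0' : 0 < e := by
      by_contra h
      have : e = 0 := by linarith
      subst this; linarith
    obtain ⟨k1, k2⟩ := key ((1 - q * (1 + e) / q') / e) (by
      have : q * (1 + e) / q' ≤ 1 := by rw [div_le_one hq']; exact h1.le
      have : 1 - e ≤ q * (1 + e) / q' := by rw [le_div_iff₀ hq']; linarith
      constructor
      · apply div_nonneg <;> linarith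
      · rw [div_le_one e0']; linarith)
    refine ⟨_, k1, π, ⟨Real.pi_pos.le, le_rfl⟩, ?_⟩
    have : dminus q' e' q e (Real.arccos ((1 - q * (1 + e) / q') / e)) π = 0 := by
      unfold dminus rminus
      rw [k2, Real.cos_pi]
      have h2 : 1 - e * ((1 - q * (1 + e) / q') / e) = q * (1 + e) / q' := by
        field_simp; ring
      rw [h2]
      apply equot_sub_zero
      · linarith
      · positivity
      · field_simp; ring
    rw [this, mul_zero]
  rcases lt_or_ge Q' (q * (1 + e)) with h2 | h2
  · have e0' : 0 < e := by
      by_contra h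
      have : e = 0 := by linarith
      subst this; linarith
    obtain ⟨k1, k2⟩ := key ((q * (1 + e) / Q' - 1) / e) (by
      have : 1 ≤ q * (1 + e) / Q' := by rw [one_le_div hQ0]; exact h2.le
      have : q * (1 + e) / Q' ≤ 1 + e := by rw [div_le_iff₀ hQ0]; nlinarith
      constructor
      · apply div_nonneg <;> linarith
      · rw [div_le_one e0']; linarith)
    refine ⟨_, k1, π, ⟨Real.pi_pos.le, le_rfl⟩, ?_⟩
    have : dplus q' e' q e (Real.arccos ((q * (1 + e) / Q' - 1) / e)) π = 0 := by
      unfold dplus rplus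
      rw [k2, Real.cos_pi]
      have h2 : 1 + e * ((q * (1 + e) / Q' - 1) / e) = q * (1 + e) / Q' := by
        field_simp; ring
      rw [h2]
      apply equot_sub_zero
      · linarith
      · positivity
      · rw [← hQ]; field_simp; ring
    rw [this, zero_mul]
  · have a1 : q' * (1 + e') / (q * (1 + e)) ≤ 1 + e' := by
      rw [div_le_iff₀ hp]; nlinarith
    have a2 : 1 - e' ≤ q' * (1 + e') / (q * (1 + e)) := by
      rw [le_div_iff₀ hp]; nlinarith
    refine ⟨π / 2, ⟨by positivity, le_rfl⟩,
      Real.arccos ((q' * (1 + e') / (q * (1 + e)) - 1) / e'),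
      ⟨Real.arccos_nonneg _, Real.arccos_le_pi _⟩, ?_⟩
    have : dplus q' e' q e (π / 2)
        (Real.arccos ((q' * (1 + e') / (q * (1 + e)) - 1) / e')) = 0 := by
      unfold dplus rplus
      rw [Real.cos_arccos (by rw [le_div_iff₀ f0]; linarith) (by rw [div_le_one f0]; linarith),
        Real.cos_pi_div_two]
      have h2 : 1 + e' * ((q' * (1 + e') / (q * (1 + e)) - 1) / e')
          = q' * (1 + e') / (q * (1 + e)) := by
        rw [mul_div_cancel₀ _ f0.ne']; ring
      rw [h2]
      apply equot_sub_zero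
      · positivity
      · simp
      · rw [mul_div_cancel₀ _ hp.ne']; ring
    rw [this, zero_mul]
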